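/- Let q and q_1 be positive integers with gcd(q, q_1) = 1. If 30(q + q_1) is a perfect square, then gcd(q, 30) = 1. -/

import Mathlib

theorem stmt_6 (q q₁ : ℕ) (hq : 0 < q) (hq₁ : 0 < q₁)
    (hcop : Nat.gcd q q₁ = 1) (hsq : IsSquare (30 * (q + q₁))) :
    Nat.gcd q 30 = 1 := by
  obtain ⟨r, hr⟩ := hsq
  have key : ∀ p : ℕ, p.Prime → p ∣ 30 → p ∣ r := fun p hp h => by
    have h1 : p ∣ r * r := hr ▸ h.mul_right _
    exact (hp.dvd_mul.1 h1).elim id id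
  have h2 := key 2 (by norm_num) (by norm_num)
  have h3 := key 3 (by norm_num) (by norm_num)
  have h5 := key 5 (by norm_num) (by norm_num)
  have h30 : 30 ∣ r := by omega
  obtain ⟨k, rfl⟩ := h30
  have hs : q + q₁ = 30 * (k * k) := by
    have : 30 * (q + q₁) = 30 * (30 * (k * k)) := by rw [hr]; ring
    omega
  have hd : Nat.gcd q 30 ∣ q + q₁ := hs ▸ (Nat.gcd_dvd_right q 30).mul_right _
  have hd1 : Nat.gcd q 30 ∣ q₁ := (Nat.dvd_add_right (Nat.gcd_dvd_left q 30)).1 hd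
  exact Nat.dvd_one.1 (hcop ▸ Nat.dvd_gcd (Nat.gcd_dvd_left q 30) hd1)
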